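/- arXiv:1612.03208 — 3 statements merged into one kernel-verified Lean document; each statement's English description precedes it below -/
import Mathlib

section
/- Let k be a probability measure on the unit circle S¹ = {τ ∈ ℂ : |τ| = 1} and let ρ > 0 be a constant. Define Γ(z) = ∫_{S¹} Log((1 - z·conj(τ))/ρ) dk(τ) for z in the open unit disk, where Log is the principal branch of the complex logarithm (well defined since Re(1 - z·conj(τ)) > 0 for |z| < 1, |τ| = 1). Then Γ is complex-differentiable on the open unit disk, and for every z with |z| < 1 the Carathéodory function K(z) = ∫_{S¹} (τ+z)/(τ-z) dk(τ) satisfies K(z) = 1 - 2z·Γ'(z). -/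
open MeasureTheory Complex Filter Topology

/-- For `z` in the open unit disk and `τ` on the unit circle, `1 - z * conj τ` lies in the right
half-plane. -/
lemma one_sub_mul_conj_re_pos {z τ : ℂ} (hz : ‖z‖ < 1) (hτ : ‖τ‖ = 1) :
    0 < (1 - z * (starRingEnd ℂ) τ).re := by
  have h := Complex.re_le_norm (z * (starRingEnd ℂ) τ)
  rw [norm_mul, RCLike.norm_conj, hτ, mul_one] at h
  rw [Complex.sub_re, Complex.one_re]
  linarith

lemma one_sub_mul_conj_div_mem_slitPlane {z τ : ℂ} (hz : ‖z‖ < 1) (hτ : ‖τ‖ = 1)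
    {ρ : ℝ} (hρ : 0 < ρ) :
    (1 - z * (starRingEnd ℂ) τ) / (ρ : ℂ) ∈ Complex.slitPlane := by
  left
  rw [Complex.div_ofReal_re]
  exact div_pos (one_sub_mul_conj_re_pos hz hτ) hρ

lemma one_sub_mul_conj_ne_zero {z τ : ℂ} (hz : ‖z‖ < 1) (hτ : ‖τ‖ = 1) :
    1 - z * (starRingEnd ℂ) τ ≠ 0 := by
  intro h
  simpa [h] using one_sub_mul_conj_re_pos hz hτ

lemma hasDerivAt_log_one_sub_mul_conj_div {z τ : ℂ} (hz : ‖z‖ < 1) (hτ : ‖τ‖ = 1)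
    {ρ : ℝ} (hρ : 0 < ρ) :
    HasDerivAt (fun w : ℂ ↦ Complex.log ((1 - w * (starRingEnd ℂ) τ) / (ρ : ℂ)))
      (-(starRingEnd ℂ) τ / (1 - z * (starRingEnd ℂ) τ)) z := by
  have hρ' : (ρ : ℂ) ≠ 0 := Complex.ofReal_ne_zero.2 hρ.ne'
  have h := ((((hasDerivAt_id z).mul_const ((starRingEnd ℂ) τ)).const_sub 1).div_const
    (ρ : ℂ)).clog (one_sub_mul_conj_div_mem_slitPlane hz hτ hρ)
  simpa only [id_eq, one_mul, div_div_div_cancel_right₀ hρ'] using h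

lemma norm_neg_conj_div_one_sub_mul_conj_le {r : ℝ} (hr : r < 1) {z τ : ℂ} (hz : ‖z‖ ≤ r)
    (hτ : ‖τ‖ = 1) :
    ‖-(starRingEnd ℂ) τ / (1 - z * (starRingEnd ℂ) τ)‖ ≤ 1 / (1 - r) := by
  have h := norm_sub_norm_le 1 (z * (starRingEnd ℂ) τ)
  rw [norm_mul, RCLike.norm_conj, hτ, mul_one, norm_one] at h
  rw [norm_div, norm_neg, RCLike.norm_conj, hτ]
  exact one_div_le_one_div_of_le (by linarith) (by linarith)

lemma integrable_log_one_sub_mul_conj_div {k : Measure ℂ} [IsFiniteMeasure k]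
    (hk : ∀ᵐ τ ∂k, ‖τ‖ = 1) {ρ : ℝ} (hρ : 0 < ρ) {z : ℂ} (hz : ‖z‖ < 1) :
    Integrable (fun τ ↦ Complex.log ((1 - z * (starRingEnd ℂ) τ) / (ρ : ℂ))) k := by
  have hcont : ContinuousOn (fun τ ↦ Complex.log ((1 - z * (starRingEnd ℂ) τ) / (ρ : ℂ)))
      (Metric.sphere 0 1) :=
    ContinuousOn.clog (by fun_prop) fun τ hτ ↦
      one_sub_mul_conj_div_mem_slitPlane hz (mem_sphere_zero_iff_norm.1 hτ) hρ
  obtain ⟨C, hC⟩ := (isCompact_sphere (0 : ℂ) 1).exists_bound_of_continuousOn hcont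
  refine Integrable.of_bound (Measurable.aestronglyMeasurable (by fun_prop)) C ?_
  filter_upwards [hk] with τ hτ using hC τ (mem_sphere_zero_iff_norm.2 hτ)

lemma add_div_sub_eq_one_sub_two_mul {z τ : ℂ} (hz : ‖z‖ < 1) (hτ : ‖τ‖ = 1) :
    (τ + z) / (τ - z) =
      1 - 2 * z * (-(starRingEnd ℂ) τ / (1 - z * (starRingEnd ℂ) τ)) := by
  have hne := one_sub_mul_conj_ne_zero hz hτ
  have hsub : τ - z ≠ 0 := by
    intro h
    rw [sub_eq_zero.1 h] at hτ
    exact hz.ne hτ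
  have hmul : τ * (starRingEnd ℂ) τ = 1 := by
    rw [Complex.mul_conj, Complex.normSq_eq_norm_sq, hτ]
    norm_num
  field_simp
  linear_combination (-2 * z) * hmul

/-- Let `k` be a probability measure on the unit circle and `ρ > 0`. Define
`Γ(z) = ∫ Log((1 - z·conj τ)/ρ) dk(τ)` on the open unit disk (principal branch).
Then `Γ` is complex-differentiable on the open unit disk and the Carathéodory
function `K(z) = ∫ (τ+z)/(τ-z) dk(τ)` satisfies `K(z) = 1 - 2z·Γ'(z)` there. -/
theorem caratheodory_eq_one_sub_two_mul_deriv_logPotential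
    (k : Measure ℂ) [IsProbabilityMeasure k] (hk : ∀ᵐ τ ∂k, ‖τ‖ = 1)
    (ρ : ℝ) (hρ : 0 < ρ)
    (Γ : ℂ → ℂ)
    (hΓ : ∀ z : ℂ, ‖z‖ < 1 →
      Γ z = ∫ τ, Complex.log ((1 - z * (starRingEnd ℂ) τ) / (ρ : ℂ)) ∂k) :
    ∀ z : ℂ, ‖z‖ < 1 →
      DifferentiableAt ℂ Γ z ∧
      ∫ τ, (τ + z) / (τ - z) ∂k = 1 - 2 * z * deriv Γ z := by
  intro z hz
  obtain ⟨r, hzr, hr⟩ := exists_between hz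
  have hball : Metric.ball (0 : ℂ) r ∈ 𝓝 z :=
    Metric.isOpen_ball.mem_nhds (mem_ball_zero_iff.2 hzr)
  have hmem : ∀ w ∈ Metric.ball (0 : ℂ) r, ‖w‖ < r := fun w hw ↦ mem_ball_zero_iff.1 hw
  obtain ⟨hint, hderiv⟩ := hasDerivAt_integral_of_dominated_loc_of_deriv_le
    (μ := k) (bound := fun _ ↦ 1 / (1 - r))
    (F := fun w τ ↦ Complex.log ((1 - w * (starRingEnd ℂ) τ) / (ρ : ℂ)))
    (F' := fun w τ ↦ -(starRingEnd ℂ) τ / (1 - w * (starRingEnd ℂ) τ)) hball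
    (.of_forall fun w ↦ Measurable.aestronglyMeasurable (by fun_prop))
    (integrable_log_one_sub_mul_conj_div hk hρ hz)
    (Measurable.aestronglyMeasurable (by fun_prop))
    (hk.mono fun τ hτ w hw ↦ norm_neg_conj_div_one_sub_mul_conj_le hr (hmem w hw).le hτ)
    (integrable_const _)
    (hk.mono fun τ hτ w hw ↦
      hasDerivAt_log_one_sub_mul_conj_div ((hmem w hw).trans hr) hτ hρ)
  have hΓz : HasDerivAt Γ (∫ τ, -(starRingEnd ℂ) τ / (1 - z * (starRingEnd ℂ) τ) ∂k) z :=
    hderiv.congr_of_eventuallyEq <| by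
      filter_upwards [hball] with w hw using hΓ w ((hmem w hw).trans hr)
  refine ⟨hΓz.differentiableAt, ?_⟩
  rw [hΓz.deriv, integral_congr_ae (hk.mono fun τ hτ ↦ add_div_sub_eq_one_sub_two_mul hz hτ),
    integral_sub (integrable_const _) (hint.const_mul _), integral_const_mul]
  simp
end

section
/- Let k be a probability measure on the unit circle S¹ = {τ ∈ ℂ : |τ| = 1}, let ρ > 0, and define the logarithmic potential u(z) = ∫_{S¹} log|1 - z·conj(τ)| dk(τ) - log ρ for z ∈ ℂ (an extended-real-valued integral, possibly -∞ at points of S¹). Let k^{(ac)} : [0,2π) → [0,∞) denote the density, with respect to Lebesgue measure dθ on [0,2π), of the absolutely continuous part of the pushforward of k under e^{iθ} ↦ θ. Then for Lebesgue-almost every θ ∈ [0,2π) satisfying u(e^{iθ}) = 0, the limit lim_{r↑1} u(re^{iθ})/(1-r) exists and k^{(ac)}(θ) = 1/(2π) + (1/π)·lim_{r↑1} u(re^{iθ})/(1-r). -/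
open MeasureTheory Complex Filter Topology

/-- The angle in `[0, 2π)` of a point on the unit circle: the inverse of
`θ ↦ e^{iθ}`, used to push measures on the circle forward to `[0, 2π)`. -/
noncomputable def circleAngle (τ : ℂ) : ℝ :=
  if 0 ≤ Complex.arg τ then Complex.arg τ else Complex.arg τ + 2 * Real.pi

theorem integral_two_mul_div_one_add_sq (y : ℝ) :
    ∫ t in (0 : ℝ)..y, 2 * t / (1 + t ^ 2) = Real.log (1 + y ^ 2) := by
  have h : ∀ t ∈ Set.uIcc 0 y, HasDerivAt (fun t : ℝ => Real.log (1 + t ^ 2))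
      (2 * t / (1 + t ^ 2)) t := by
    intro t _
    have h1 : HasDerivAt (fun t : ℝ => 1 + t ^ 2) (2 * t) t := by
      simpa using (hasDerivAt_pow 2 t).const_add 1
    exact h1.log (by positivity)
  rw [intervalIntegral.integral_eq_sub_of_hasDerivAt h]
  · simp
  · apply Continuous.intervalIntegrable
    exact Continuous.div (by fun_prop) (by fun_prop) (fun t => by positivity)

theorem integral_log_one_add_sq_eq {α : Type*} [MeasurableSpace α] (k : Measure α)
    [IsFiniteMeasure k] {g : α → ℝ} (hg : Measurable g) (hg0 : ∀ x, 0 ≤ g x) :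
    ∫ x, Real.log (1 + g x ^ 2) ∂k
      = ∫ t in Set.Ioi (0 : ℝ), k.real {x | t ≤ g x} * (2 * t / (1 + t ^ 2)) := by
  have hcont : Continuous fun t : ℝ => 2 * t / (1 + t ^ 2) :=
    Continuous.div (by fun_prop) (by fun_prop) (fun t => by positivity)
  have hanti : Antitone fun t : ℝ => k.real {x | t ≤ g x} := fun s t hst =>
    measureReal_mono (fun x (hx : t ≤ g x) => hst.trans hx)
  have hmeas : Measurable fun t : ℝ => k.real {x | t ≤ g x} * (2 * t / (1 + t ^ 2)) :=
    hanti.measurable.mul hcont.measurable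
  have hlc := lintegral_comp_eq_lintegral_meas_le_mul k (f := g)
    (g := fun t : ℝ => 2 * t / (1 + t ^ 2)) (ae_of_all _ hg0) hg.aemeasurable
    (fun t _ => hcont.intervalIntegrable _ _)
    (by
      filter_upwards [self_mem_ae_restrict measurableSet_Ioi] with t ht
      have : 0 < t := ht
      positivity)
  rw [integral_eq_lintegral_of_nonneg_ae
      (ae_of_all _ fun x => Real.log_nonneg (by nlinarith [sq_nonneg (g x)]))
      (Real.measurable_log.comp (by fun_prop :
        Measurable fun x => 1 + g x ^ 2)).aestronglyMeasurable,
    integral_eq_lintegral_of_nonneg_ae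
      (by
        filter_upwards [self_mem_ae_restrict measurableSet_Ioi] with t ht
        have : 0 < t := ht
        simp only [Pi.zero_apply]
        positivity)
      hmeas.aestronglyMeasurable]
  congr 1
  calc _ = _ := lintegral_congr fun x => by rw [← integral_two_mul_div_one_add_sq (g x)]
    _ = _ := hlc
    _ = _ := lintegral_congr fun t => by
      rw [ENNReal.ofReal_mul measureReal_nonneg, ofReal_measureReal]

theorem tendsto_integral_log_one_add_sq_div {α : Type*} [MeasurableSpace α] (k : Measure α)
    [IsProbabilityMeasure k] {f : α → ℝ} (hf : Measurable f) (hf0 : ∀ x, 0 ≤ f x)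
    (hfpos : ∀ᵐ x ∂k, 0 < f x) {D : ℝ}
    (hD : Tendsto (fun a => k.real {x | f x ≤ a} / a) (𝓝[>] 0) (𝓝 D)) :
    Tendsto (fun c => (∫ x, Real.log (1 + (c / f x) ^ 2) ∂k) / c) (𝓝[>] 0)
      (𝓝 (Real.pi * D)) := by
  obtain ⟨B, hB⟩ : ∃ B, ∀ a > 0, k.real {x | f x ≤ a} / a ≤ B := by
    have h1 : ∀ᶠ a in 𝓝[>] (0 : ℝ), k.real {x | f x ≤ a} / a < D + 1 :=
      hD.eventually_lt_const (by linarith)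
    obtain ⟨δ, hδ, h⟩ := mem_nhdsGT_iff_exists_Ioo_subset.1 h1
    have hδ' : 0 < δ := hδ
    refine ⟨max (D + 1) (1 / δ), fun a ha => ?_⟩
    rcases lt_or_ge a δ with h2 | h2
    · exact (le_of_lt (h ⟨ha, h2⟩)).trans (le_max_left _ _)
    · refine le_trans ?_ (le_max_right _ _)
      gcongr
      exact measureReal_le_one
  have heq : ∀ c > 0, (∫ x, Real.log (1 + (c / f x) ^ 2) ∂k) / c
      = ∫ t in Set.Ioi (0 : ℝ),
          (k.real {x | f x ≤ c / t} / (c / t)) * (2 * (1 + t ^ 2)⁻¹) := by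
    intro c hc
    rw [integral_log_one_add_sq_eq k (g := fun x => c / f x) (by fun_prop)
      (fun x => div_nonneg hc.le (hf0 x)), ← integral_div]
    refine setIntegral_congr_fun measurableSet_Ioi fun t (ht : 0 < t) => ?_
    have : k.real {x | t ≤ c / f x} = k.real {x | f x ≤ c / t} := by
      refine measureReal_congr ?_
      filter_upwards [hfpos] with x hx
      change (t ≤ c / f x) = (f x ≤ c / t)
      rw [le_div_iff₀ hx, le_div_iff₀ ht, mul_comm]
    simp only [this]
    generalize k.real {x | f x ≤ c / t} = G
    field_simp
  have hint : ∫ t in Set.Ioi (0 : ℝ), D * (2 * (1 + t ^ 2)⁻¹) = Real.pi * D := by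
    rw [integral_const_mul, integral_const_mul, integral_Ioi_inv_one_add_sq]
    simp
    ring
  rw [← hint]
  refine Tendsto.congr' (f₁ := fun c => ∫ t in Set.Ioi (0 : ℝ),
    (k.real {x | f x ≤ c / t} / (c / t)) * (2 * (1 + t ^ 2)⁻¹)) ?_ ?_
  · filter_upwards [self_mem_nhdsWithin] with c hc using (heq c hc).symm
  have hmono : Monotone fun a : ℝ => k.real {x | f x ≤ a} := fun s t hst =>
    measureReal_mono (fun x (hx : f x ≤ s) => hx.trans hst)
  refine tendsto_integral_filter_of_dominated_convergence
    (fun t => B * (2 * (1 + t ^ 2)⁻¹)) ?_ ?_ ?_ ?_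
  · refine Eventually.of_forall fun c => Measurable.aestronglyMeasurable ?_
    have := hmono.measurable
    exact ((this.comp (by fun_prop : Measurable fun t : ℝ => c / t)).div (by fun_prop)).mul
      (by fun_prop)
  · filter_upwards [self_mem_nhdsWithin] with c hc
    filter_upwards [self_mem_ae_restrict measurableSet_Ioi] with t ht
    have hc' : 0 < c := hc
    have ht' : 0 < t := ht
    have := hB (c / t) (by positivity)
    rw [Real.norm_of_nonneg (by positivity)]
    gcongr
  · exact ((integrable_inv_one_add_sq.const_mul 2).const_mul B).integrableOn
  · filter_upwards [self_mem_ae_restrict measurableSet_Ioi] with t ht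
    have ht' : 0 < t := ht
    refine Tendsto.mul_const _ (hD.comp ?_)
    refine tendsto_nhdsWithin_iff.2 ⟨?_, ?_⟩
    · have : Tendsto (fun c : ℝ => c / t) (𝓝 0) (𝓝 (0 / t)) := tendsto_id.div_const t
      rw [zero_div] at this
      exact this.mono_left nhdsWithin_le_nhds
    · filter_upwards [self_mem_nhdsWithin] with c hc
      exact div_pos hc ht'
theorem measurable_circleAngle : Measurable circleAngle :=
  Measurable.ite (measurableSet_le measurable_const measurable_arg) measurable_arg
    (measurable_arg.add_const _)

theorem circleAngle_mem_Ico (τ : ℂ) : circleAngle τ ∈ Set.Ico 0 (2 * Real.pi) := by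
  have h1 := neg_pi_lt_arg τ
  have h2 := arg_le_pi τ
  have h3 := Real.pi_pos
  unfold circleAngle
  split_ifs with h
  · exact ⟨h, by linarith⟩
  · exact ⟨by linarith, by linarith [not_le.1 h]⟩

theorem exp_circleAngle {τ : ℂ} (hτ : ‖τ‖ = 1) : exp (circleAngle τ * I) = τ := by
  have h := norm_mul_exp_arg_mul_I τ
  rw [hτ, ofReal_one, one_mul] at h
  unfold circleAngle
  split_ifs
  · exact h
  · rw [ofReal_add, add_mul, exp_add, h]
    push_cast
    rw [exp_two_pi_mul_I, mul_one]

theorem norm_one_sub_exp_mul_conj {τ : ℂ} (hτ : ‖τ‖ = 1) (θ : ℝ) :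
    ‖1 - exp (θ * I) * (starRingEnd ℂ) τ‖ = 2 * |Real.sin ((circleAngle τ - θ) / 2)| := by
  have h : exp (θ * I) * (starRingEnd ℂ) τ = exp (I * ((θ - circleAngle τ : ℝ) : ℂ)) := by
    conv_lhs => rw [← exp_circleAngle hτ, ← exp_conj]
    rw [← exp_add]
    congr 1
    simp
    ring
  rw [h, norm_sub_rev, norm_exp_I_mul_ofReal_sub_one, norm_mul, Real.norm_eq_abs,
    Real.norm_eq_abs, abs_two, ← neg_sub (circleAngle τ), neg_div, Real.sin_neg, abs_neg]

theorem sin_le_iff_le_arcsin {x b : ℝ} (hx0 : 0 ≤ x) (hb : 0 ≤ b) (hb1 : b ≤ 1)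
    (hx : x < Real.pi - Real.arcsin b) : Real.sin x ≤ b ↔ x ≤ Real.arcsin b := by
  have hβ := Real.arcsin_nonneg.2 hb
  have hβ2 := Real.arcsin_le_pi_div_two b
  have hs := Real.sin_arcsin (by linarith) hb1
  have hpi := Real.pi_pos
  constructor
  · intro h
    by_contra! hlt
    rcases le_or_gt x (Real.pi / 2) with h2 | h2
    · have := Real.sin_lt_sin_of_lt_of_le_pi_div_two (by linarith) h2 hlt
      linarith
    · have := Real.sin_lt_sin_of_lt_of_le_pi_div_two (x := Real.arcsin b) (y := Real.pi - x)
        (by linarith) (by linarith) (by linarith)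
      rw [Real.sin_pi_sub] at this
      linarith
  · intro h
    have := Real.sin_le_sin_of_le_of_le_pi_div_two (by linarith) hβ2 h
    linarith

theorem eventually_norm_one_sub_le_iff {θ : ℝ} (hθ0 : 0 < θ) (hθ : θ < 2 * Real.pi) :
    ∀ᶠ a in 𝓝[>] (0 : ℝ), ∀ τ : ℂ, ‖τ‖ = 1 →
      (‖1 - exp (θ * I) * (starRingEnd ℂ) τ‖ ≤ a ↔
        circleAngle τ ∈ Metric.closedBall θ (2 * Real.arcsin (a / 2))) := by
  have hlim : Tendsto (fun a : ℝ => Real.arcsin (a / 2)) (𝓝[>] 0) (𝓝 0) := by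
    have : Continuous fun a : ℝ => Real.arcsin (a / 2) :=
      Real.continuous_arcsin.comp (by fun_prop)
    simpa using (this.tendsto 0).mono_left nhdsWithin_le_nhds
  filter_upwards [hlim.eventually_lt_const (show 0 < θ / 2 by linarith),
    hlim.eventually_lt_const (show 0 < Real.pi - θ / 2 by linarith),
    Ioo_mem_nhdsGT (show (0 : ℝ) < 2 by norm_num)] with a h1 h2 ha τ hτ
  obtain ⟨ha0, ha2⟩ := ha
  obtain ⟨hφ0, hφ⟩ := circleAngle_mem_Ico τ
  have hsin : |Real.sin ((circleAngle τ - θ) / 2)| = Real.sin |(circleAngle τ - θ) / 2| := by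
    rw [Real.abs_sin_eq_sin_abs_of_abs_le_pi]
    rw [abs_le]
    constructor <;> linarith
  have hx : |(circleAngle τ - θ) / 2| < Real.pi - Real.arcsin (a / 2) := by
    rw [abs_lt]
    constructor <;> linarith
  have key := sin_le_iff_le_arcsin (abs_nonneg _) (by linarith : 0 ≤ a / 2) (by linarith) hx
  rw [norm_one_sub_exp_mul_conj hτ, hsin, Metric.mem_closedBall, Real.dist_eq]
  rw [abs_div, abs_two] at key ⊢
  rw [mul_comm 2 (Real.sin _), mul_comm 2 (Real.arcsin _), ← div_le_iff₀ two_pos, ← key,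
    le_div_iff₀ two_pos]

theorem tendsto_two_mul_arcsin_half_div :
    Tendsto (fun a : ℝ => 2 * Real.arcsin (a / 2) / a) (𝓝[>] 0) (𝓝 1) := by
  have h0 : HasDerivAt Real.arcsin 1 ((0 : ℝ) / 2) := by
    simpa using Real.hasDerivAt_arcsin (x := 0) (by norm_num) (by norm_num)
  have h := ((h0.comp (0 : ℝ) ((hasDerivAt_id (0 : ℝ)).div_const 2)).const_mul 2)
  have h' := (hasDerivAt_iff_tendsto_slope_left_right.1 h).2
  refine (h'.congr' ?_).trans (by norm_num)
  filter_upwards [self_mem_nhdsWithin] with a _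
  simp [slope_def_field]

theorem ae_tendsto_real_norm_one_sub_le_div (k : Measure ℂ) [IsProbabilityMeasure k]
    (hk : ∀ᵐ τ ∂k, ‖τ‖ = 1) :
    ∀ᵐ (θ : ℝ) ∂(volume.restrict (Set.Ico (0 : ℝ) (2 * Real.pi))),
      Tendsto (fun a => k.real {τ | ‖1 - exp (θ * I) * (starRingEnd ℂ) τ‖ ≤ a} / a) (𝓝[>] 0)
        (𝓝 (2 * ((k.map circleAngle).rnDeriv volume θ).toReal)) := by
  have : IsProbabilityMeasure (k.map circleAngle) :=
    Measure.isProbabilityMeasure_map measurable_circleAngle.aemeasurable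
  have hne : ∀ᵐ θ : ℝ, θ ≠ 0 := by simp [ae_iff]
  filter_upwards [ae_restrict_of_ae (Besicovitch.ae_tendsto_rnDeriv (k.map circleAngle) volume),
    ae_restrict_of_ae (Measure.rnDeriv_lt_top (k.map circleAngle) volume),
    ae_restrict_of_ae hne, self_mem_ae_restrict measurableSet_Ico] with θ hB hfin hθne hθ
  have hθ0 : 0 < θ := lt_of_le_of_ne hθ.1 hθne.symm
  have hball : Tendsto (fun b => (k.map circleAngle).real (Metric.closedBall θ b) / (2 * b))
      (𝓝[>] 0) (𝓝 ((k.map circleAngle).rnDeriv volume θ).toReal) := by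
    refine ((ENNReal.tendsto_toReal hfin.ne).comp hB).congr' ?_
    filter_upwards [self_mem_nhdsWithin] with b hb
    have hb' : 0 < b := hb
    simp only [Function.comp_apply, Real.volume_closedBall, ENNReal.toReal_div]
    rw [ENNReal.toReal_ofReal (by positivity), measureReal_def]
  have harc : Tendsto (fun a : ℝ => 2 * Real.arcsin (a / 2)) (𝓝[>] 0) (𝓝[>] 0) := by
    refine tendsto_nhdsWithin_iff.2 ⟨?_, ?_⟩
    · have : Continuous fun a : ℝ => 2 * Real.arcsin (a / 2) :=
        (Real.continuous_arcsin.comp (by fun_prop)).const_mul 2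
      simpa using (this.tendsto 0).mono_left nhdsWithin_le_nhds
    · filter_upwards [self_mem_nhdsWithin] with a ha
      have ha' : 0 < a := ha
      have : 0 < Real.arcsin (a / 2) := Real.arcsin_pos.2 (by linarith)
      exact mul_pos two_pos this
  have hlim := ((hball.comp harc).mul tendsto_two_mul_arcsin_half_div).const_mul 2
  rw [mul_one] at hlim
  refine hlim.congr' ?_
  filter_upwards [eventually_norm_one_sub_le_iff hθ0 hθ.2, self_mem_nhdsWithin,
    harc.eventually self_mem_nhdsWithin] with a hiff ha hpos
  have ha' : 0 < a := ha
  have hpos' : 0 < 2 * Real.arcsin (a / 2) := hpos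
  have hmeas : (k.map circleAngle).real (Metric.closedBall θ (2 * Real.arcsin (a / 2)))
      = k.real {τ | ‖1 - exp (θ * I) * (starRingEnd ℂ) τ‖ ≤ a} := by
    rw [map_measureReal_apply measurable_circleAngle measurableSet_closedBall]
    refine measureReal_congr ?_
    filter_upwards [hk] with τ hτ
    exact propext (hiff τ hτ).symm
  simp only [Function.comp_apply]
  rw [hmeas]
  generalize 2 * Real.arcsin (a / 2) = b at hpos'
  field_simp

theorem norm_one_sub_mul_sq {w : ℂ} (hw : ‖w‖ = 1) (r : ℝ) :
    ‖1 - r * w‖ ^ 2 = (1 - r) ^ 2 + r * ‖1 - w‖ ^ 2 := by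
  have h : w.re ^ 2 + w.im ^ 2 = 1 := by
    have := Complex.sq_norm w
    rw [hw, normSq_apply] at this
    linarith
  rw [Complex.sq_norm, Complex.sq_norm, normSq_apply, normSq_apply]
  simp
  linear_combination (r ^ 2 - r) * h

theorem log_norm_one_sub_mul {w : ℂ} (hw : ‖w‖ = 1) (hw1 : 0 < ‖1 - w‖) {r : ℝ} (hr : 0 < r) :
    Real.log ‖1 - r * w‖ = Real.log ‖1 - w‖ + Real.log r / 2
      + Real.log (1 + ((1 - r) / √r / ‖1 - w‖) ^ 2) / 2 := by
  have hsq : ‖1 - r * w‖ ^ 2 = ‖1 - w‖ ^ 2 * r * (1 + ((1 - r) / √r / ‖1 - w‖) ^ 2) := by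
    rw [norm_one_sub_mul_sq hw, div_pow, div_pow, Real.sq_sqrt hr.le]
    field_simp
    ring
  have := congrArg Real.log hsq
  rw [Real.log_mul (by positivity) (by positivity), Real.log_mul (by positivity) hr.ne',
    Real.log_pow, Real.log_pow] at this
  push_cast at this
  linarith

theorem integrable_log_norm_one_sub_mul (k : Measure ℂ) [IsProbabilityMeasure k]
    (hk : ∀ᵐ τ ∂k, ‖τ‖ = 1) {z : ℂ} (hz : ‖z‖ < 1) :
    Integrable (fun τ => Real.log ‖1 - z * (starRingEnd ℂ) τ‖) k := by
  refine Integrable.of_mem_Icc (Real.log (1 - ‖z‖)) (Real.log 2) ?_ ?_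
  · exact (Real.measurable_log.comp (by fun_prop)).aemeasurable
  · filter_upwards [hk] with τ hτ
    have hn : ‖z * (starRingEnd ℂ) τ‖ = ‖z‖ := by rw [norm_mul, RCLike.norm_conj, hτ, mul_one]
    have h1 : 1 - ‖z‖ ≤ ‖1 - z * (starRingEnd ℂ) τ‖ := by
      have := norm_sub_norm_le 1 (z * (starRingEnd ℂ) τ)
      rwa [hn, norm_one] at this
    have h2 : ‖1 - z * (starRingEnd ℂ) τ‖ ≤ 2 := by
      have := norm_sub_le 1 (z * (starRingEnd ℂ) τ)
      rw [hn, norm_one] at this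
      linarith
    exact ⟨Real.log_le_log (by linarith) h1, Real.log_le_log (by linarith) h2⟩

theorem ae_pos_of_tendsto_measureReal_div {α : Type*} [MeasurableSpace α] (k : Measure α)
    [IsFiniteMeasure k] {f : α → ℝ} {D : ℝ}
    (hD : Tendsto (fun a => k.real {x | f x ≤ a} / a) (𝓝[>] 0) (𝓝 D)) :
    ∀ᵐ x ∂k, 0 < f x := by
  have h0 : Tendsto (fun a => k.real {x | f x ≤ a} / a * a) (𝓝[>] 0) (𝓝 (D * 0)) :=
    hD.mul (tendsto_id.mono_left nhdsWithin_le_nhds)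
  have h1 : k.real {x | f x ≤ 0} ≤ D * 0 := by
    refine ge_of_tendsto h0 ?_
    filter_upwards [self_mem_nhdsWithin] with a ha
    have ha' : 0 < a := ha
    rw [div_mul_cancel₀ _ ha'.ne']
    exact measureReal_mono fun x (hx : f x ≤ 0) => hx.trans ha'.le
  rw [mul_zero] at h1
  have h2 := (measureReal_eq_zero_iff).1 (le_antisymm h1 measureReal_nonneg)
  simpa [ae_iff] using h2

theorem tendsto_log_div_one_sub :
    Tendsto (fun r : ℝ => Real.log r / (1 - r)) (𝓝[<] 1) (𝓝 (-1)) := by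
  have h := Real.hasDerivAt_log one_ne_zero
  have h' := (hasDerivAt_iff_tendsto_slope_left_right.1 h).1.neg
  rw [inv_one] at h'
  refine h'.congr' ?_
  filter_upwards [self_mem_nhdsWithin] with r _
  rw [slope_def_field, Real.log_one, sub_zero, ← div_neg, neg_sub]

theorem tendsto_one_sub_div_sqrt :
    Tendsto (fun r : ℝ => (1 - r) / √r) (𝓝[<] 1) (𝓝[>] 0) := by
  refine tendsto_nhdsWithin_iff.2 ⟨?_, ?_⟩
  · have : ContinuousAt (fun r : ℝ => (1 - r) / √r) 1 := by
      refine ContinuousAt.div (by fun_prop) (by fun_prop) (by simp)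
    simpa using this.tendsto.mono_left nhdsWithin_le_nhds
  · filter_upwards [Ioo_mem_nhdsLT (zero_lt_one' ℝ)] with r hr
    exact div_pos (by linarith [hr.2]) (Real.sqrt_pos.2 hr.1)

/-- Kotani's boundary formula for CMV operators: with
`u(z) = ∫ log|1 - z·conj τ| dk(τ) - log ρ`, for Lebesgue-a.e. `θ ∈ [0,2π)` at
which `u(e^{iθ})` is (well defined, i.e. the integrand is integrable, and)
equal to `0`, the limit `lim_{r↑1} u(re^{iθ})/(1-r)` exists and the density of
the a.c. part of the pushforward of `k` under `e^{iθ} ↦ θ` satisfies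
`k^{(ac)}(θ) = 1/(2π) + (1/π)·lim_{r↑1} u(re^{iθ})/(1-r)`. -/
theorem ac_density_eq_boundary_limit_of_potential
    (k : Measure ℂ) [IsProbabilityMeasure k] (hk : ∀ᵐ τ ∂k, ‖τ‖ = 1)
    (ρ : ℝ) (hρ : 0 < ρ)
    (u : ℂ → ℝ)
    (hu : ∀ z : ℂ,
      u z = (∫ τ, Real.log ‖1 - z * (starRingEnd ℂ) τ‖ ∂k) - Real.log ρ) :
    ∀ᵐ (θ : ℝ) ∂(volume.restrict (Set.Ico (0 : ℝ) (2 * Real.pi))),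
      (Integrable
          (fun τ => Real.log ‖1 - Complex.exp (θ * Complex.I) * (starRingEnd ℂ) τ‖) k ∧
        u (Complex.exp (θ * Complex.I)) = 0) →
      ∃ L : ℝ,
        Tendsto (fun r : ℝ => u ((r : ℂ) * Complex.exp (θ * Complex.I)) / (1 - r))
          (𝓝[<] (1 : ℝ)) (𝓝 L) ∧
        ((k.map circleAngle).rnDeriv volume θ).toReal
          = 1 / (2 * Real.pi) + (1 / Real.pi) * L := by
  filter_upwards [ae_tendsto_real_norm_one_sub_le_div k hk] with θ hD
  rintro ⟨hint, hu0⟩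
  set D := ((k.map circleAngle).rnDeriv volume θ).toReal
  have hpos := ae_pos_of_tendsto_measureReal_div k hD
  have hker := tendsto_integral_log_one_add_sq_div k (by fun_prop) (fun τ => norm_nonneg _)
    hpos hD
  refine ⟨Real.pi * D - 1 / 2, ?_, by field_simp; ring⟩
  have hsqrt : Tendsto (fun r : ℝ => 1 / √r) (𝓝[<] 1) (𝓝 1) := by
    have : ContinuousAt (fun r : ℝ => 1 / √r) 1 :=
      ContinuousAt.div (by fun_prop) (by fun_prop) (by simp)
    simpa using this.tendsto.mono_left nhdsWithin_le_nhds
  have hlim := (tendsto_log_div_one_sub.div_const 2).add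
    (((hker.comp tendsto_one_sub_div_sqrt).mul hsqrt).div_const 2)
  have hval : -1 / 2 + Real.pi * (2 * D) * 1 / 2 = Real.pi * D - 1 / 2 := by ring
  rw [hval] at hlim
  refine hlim.congr' ?_
  filter_upwards [Ioo_mem_nhdsLT (zero_lt_one' ℝ)] with r hr
  obtain ⟨hr0, hr1⟩ := hr
  have hlog : (fun τ => Real.log ‖1 - r * exp (θ * I) * (starRingEnd ℂ) τ‖) =ᵐ[k]
      fun τ => (Real.log ‖1 - exp (θ * I) * (starRingEnd ℂ) τ‖ + Real.log r / 2)
        + Real.log (1 + ((1 - r) / √r / ‖1 - exp (θ * I) * (starRingEnd ℂ) τ‖) ^ 2) / 2 := by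
    filter_upwards [hk, hpos] with τ hτ hτ0
    rw [mul_assoc]
    exact log_norm_one_sub_mul (by simp [hτ, norm_exp_ofReal_mul_I]) hτ0 hr0
  have hint1 : Integrable (fun τ => Real.log ‖1 - exp (θ * I) * (starRingEnd ℂ) τ‖
      + Real.log r / 2) k := hint.add (integrable_const _)
  have hint2 : Integrable (fun τ =>
      Real.log (1 + ((1 - r) / √r / ‖1 - exp (θ * I) * (starRingEnd ℂ) τ‖) ^ 2) / 2) k := by
    have hz : ‖(r : ℂ) * exp (θ * I)‖ < 1 := by
      rw [norm_mul, norm_exp_ofReal_mul_I, mul_one, norm_real, Real.norm_of_nonneg hr0.le]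
      exact hr1
    refine (((integrable_log_norm_one_sub_mul k hk hz).congr hlog).sub hint1).congr
      (ae_of_all _ fun τ => ?_)
    simp
  have hur : u (r * exp (θ * I)) = Real.log r / 2
      + (∫ τ, Real.log (1 + ((1 - r) / √r / ‖1 - exp (θ * I) * (starRingEnd ℂ) τ‖) ^ 2) ∂k)
        / 2 := by
    rw [hu] at hu0
    rw [hu, integral_congr_ae hlog, integral_add hint1 hint2,
      integral_add hint (integrable_const _), integral_const, integral_div]
    simp
    linarith
  rw [hur]
  simp only [Function.comp_apply]
  have h1 : 0 < 1 - r := by linarith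
  have h2 : 0 < √r := Real.sqrt_pos.2 hr0
  generalize (∫ τ, Real.log (1 + ((1 - r) / √r / ‖1 - exp (θ * I) * (starRingEnd ℂ) τ‖) ^ 2) ∂k)
    = J
  field_simp
end

section
/- Let k be a probability measure on the unit circle S¹ = {τ ∈ ℂ : |τ| = 1}, let ρ > 0, and define u(z) = ∫_{S¹} log|1 - z·conj(τ)| dk(τ) - log ρ for z ∈ ℂ. Then for Lebesgue-almost every θ ∈ [0,2π) such that u(e^{iθ}) = 0, both radial limits lim_{r↑1} (∂u/∂r)(re^{iθ}) and lim_{r↑1} u(re^{iθ})/(1-r) exist and satisfy lim_{r↑1} (∂u/∂r)(re^{iθ}) = -lim_{r↑1} u(re^{iθ})/(1-r), where (∂u/∂r)(re^{iθ}) denotes the derivative of the function r ↦ u(re^{iθ}). -/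
open MeasureTheory Complex Filter Topology

section RadialKernel

lemma hasDerivAt_neg_inv_one_add_mul_sq {r : ℝ} (hr : 0 < r) (s : ℝ) :
    HasDerivAt (fun s : ℝ => -(1 + r * s ^ 2)⁻¹) (2 * r * s / (1 + r * s ^ 2) ^ 2) s := by
  have h : HasDerivAt (fun s : ℝ => 1 + r * s ^ 2) (r * (2 * s)) s := by
    simpa using ((hasDerivAt_pow 2 s).const_mul r).const_add 1
  have hne : 1 + r * s ^ 2 ≠ 0 := by positivity
  refine ((h.inv hne).neg).congr_deriv ?_
  ring

lemma tendsto_neg_inv_one_add_mul_sq {r : ℝ} (hr : 0 < r) :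
    Tendsto (fun s : ℝ => -(1 + r * s ^ 2)⁻¹) atTop (𝓝 0) := by
  have h : Tendsto (fun s : ℝ => 1 + r * s ^ 2) atTop atTop :=
    tendsto_atTop_add_const_left _ _
      ((tendsto_pow_atTop (two_ne_zero)).const_mul_atTop hr)
  simpa using h.inv_tendsto_atTop.neg

lemma integrableOn_Ioi_layer_density {r : ℝ} (hr : 0 < r) {x : ℝ} (hx : 0 ≤ x) :
    IntegrableOn (fun s : ℝ => 2 * r * s / (1 + r * s ^ 2) ^ 2) (Set.Ioi x) := by
  refine integrableOn_Ioi_deriv_of_nonneg'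
    (fun s _ => hasDerivAt_neg_inv_one_add_mul_sq hr s) (fun s hs => ?_)
    (tendsto_neg_inv_one_add_mul_sq hr)
  have : 0 < s := hx.trans_lt hs
  positivity

lemma integral_Ioi_layer_density {r : ℝ} (hr : 0 < r) {x : ℝ} (hx : 0 ≤ x) :
    ∫ s in Set.Ioi x, 2 * r * s / (1 + r * s ^ 2) ^ 2 = (1 + r * x ^ 2)⁻¹ := by
  rw [integral_Ioi_of_hasDerivAt_of_nonneg'
    (fun s _ => hasDerivAt_neg_inv_one_add_mul_sq hr s) (fun s hs => ?_)
    (tendsto_neg_inv_one_add_mul_sq hr)]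
  · ring
  · have : 0 < s := hx.trans_lt hs
    positivity

variable {α : Type*} [MeasurableSpace α]

/-- Layer-cake formula for the kernel `1 / (1 + r x²)`. -/
lemma integral_inv_one_add_mul_sq_eq (m : Measure α) [IsFiniteMeasure m] {d : α → ℝ}
    (hd : Measurable d) (hd0 : ∀ a, 0 ≤ d a) {r ε : ℝ} (hr : 0 < r) (hε : 0 < ε) :
    ∫ a, (1 + r * (d a / ε) ^ 2)⁻¹ ∂m =
      ∫ s in Set.Ioi (0 : ℝ), 2 * r * s / (1 + r * s ^ 2) ^ 2 * m.real {a | d a ≤ ε * s} := by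
  let g : ℝ → ℝ := fun s => 2 * r * s / (1 + r * s ^ 2) ^ 2
  let S : Set (α × ℝ) := {p | d p.1 ≤ ε * p.2}
  have hS : MeasurableSet S :=
    measurableSet_le (hd.comp measurable_fst) (measurable_snd.const_mul ε)
  have hg : Integrable g (volume.restrict (Set.Ioi 0)) :=
    integrableOn_Ioi_layer_density hr le_rfl
  have hint : Integrable (Function.uncurry fun a s => S.indicator (fun p => g p.2) (a, s))
      (m.prod (volume.restrict (Set.Ioi 0))) :=
    (hg.comp_snd m).indicator hS
  have hswap := integral_integral_swap hint
  have hleft : ∀ a, ∫ s in Set.Ioi (0 : ℝ), S.indicator (fun p => g p.2) (a, s) =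
      (1 + r * (d a / ε) ^ 2)⁻¹ := by
    intro a
    have hx : 0 ≤ d a / ε := div_nonneg (hd0 a) hε.le
    have hind : (fun s => S.indicator (fun p => g p.2) (a, s)) =
        (Set.Ici (d a / ε)).indicator g := by
      funext s
      have : (a, s) ∈ S ↔ s ∈ Set.Ici (d a / ε) := by
        simp only [S, Set.mem_ofPred_eq, Set.mem_Ici, div_le_iff₀ hε, mul_comm s]
      by_cases h : s ∈ Set.Ici (d a / ε)
      · rw [Set.indicator_of_mem h, Set.indicator_of_mem (this.2 h)]
      · rw [Set.indicator_of_notMem h, Set.indicator_of_notMem (mt this.1 h)]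
    have hset : (Set.Ioi 0 ∩ Set.Ici (d a / ε) : Set ℝ) =ᵐ[volume] Set.Ioi (d a / ε) := by
      refine ((ae_eq_refl (Set.Ioi (0 : ℝ))).inter Ioi_ae_eq_Ici.symm).trans ?_
      rw [Set.Ioi_inter_Ioi, sup_eq_right.2 hx]
      exact ae_eq_refl _
    rw [hind, setIntegral_indicator measurableSet_Ici, setIntegral_congr_set hset]
    exact integral_Ioi_layer_density hr hx
  have hright : ∀ s, ∫ a, S.indicator (fun p => g p.2) (a, s) ∂m =
      g s * m.real {a | d a ≤ ε * s} := by
    intro s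
    have hind : (fun a => S.indicator (fun p => g p.2) (a, s)) =
        {a | d a ≤ ε * s}.indicator (fun _ => g s) := rfl
    have hmeas : MeasurableSet {a | d a ≤ ε * s} := hd measurableSet_Iic
    rw [hind, integral_indicator_const _ hmeas, smul_eq_mul, mul_comm]
  simp only [hleft, hright] at hswap
  exact hswap

lemma exists_div_bound_of_tendsto {F : ℝ → ℝ} {A B : ℝ} (hB : ∀ t, F t ≤ B) (hB0 : 0 ≤ B)
    (hF : Tendsto (fun t => F t / t) (𝓝[>] 0) (𝓝 A)) :
    ∃ C, 0 ≤ C ∧ ∀ t, 0 < t → F t / t ≤ C := by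
  have h : ∀ᶠ t in 𝓝[>] (0 : ℝ), F t / t < A + 1 := hF.eventually_lt_const (lt_add_one A)
  obtain ⟨δ, hδ, hsub⟩ := mem_nhdsGT_iff_exists_Ioo_subset.1 h
  have hδ' : (0 : ℝ) < δ := hδ
  refine ⟨max (A + 1) (B / δ), le_max_of_le_right (by positivity), fun t ht => ?_⟩
  rcases lt_or_ge t δ with htδ | htδ
  · exact le_max_of_le_left (le_of_lt (hsub ⟨ht, htδ⟩))
  · refine le_max_of_le_right ?_
    exact (div_le_div_of_nonneg_right (hB t) ht.le).trans
      (div_le_div_of_nonneg_left hB0 hδ' htδ)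

/-- Fatou's theorem at a point: if the mass of `{d ≤ t}` is asymptotically linear in `t`, then the
Poisson averages converge as `r ↑ 1`. -/
lemma exists_tendsto_poisson (m : Measure α) [IsFiniteMeasure m] {d : α → ℝ}
    (hd : Measurable d) (hd0 : ∀ a, 0 ≤ d a) {A : ℝ}
    (hA : Tendsto (fun t => m.real {a | d a ≤ t} / t) (𝓝[>] 0) (𝓝 A)) :
    ∃ B : ℝ, Tendsto (fun r : ℝ => ∫ a, (1 - r ^ 2) / ((1 - r) ^ 2 + r * d a ^ 2) ∂m)
      (𝓝[<] 1) (𝓝 B) := by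
  set F : ℝ → ℝ := fun t => m.real {a | d a ≤ t} with hFdef
  have hF0 : ∀ t, 0 ≤ F t := fun t => measureReal_nonneg
  have hFmono : Monotone F := fun s t hst =>
    measureReal_mono (fun a (ha : d a ≤ s) => ha.trans hst)
  obtain ⟨C, hC0, hC⟩ := exists_div_bound_of_tendsto
    (fun t => measureReal_mono (Set.subset_univ {a | d a ≤ t}) : ∀ t, F t ≤ m.real Set.univ)
    measureReal_nonneg hA
  let G : ℝ → ℝ → ℝ := fun r s =>
    (1 + r) * (2 * r * s ^ 2 / (1 + r * s ^ 2) ^ 2) * (F ((1 - r) * s) / ((1 - r) * s))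
  have hr_mem : ∀ᶠ r in 𝓝[<] (1 : ℝ), r ∈ Set.Ioo (1 / 2 : ℝ) 1 :=
    Ioo_mem_nhdsLT (by norm_num)
  have hEq : ∀ r ∈ Set.Ioo (1 / 2 : ℝ) 1,
      ∫ a, (1 - r ^ 2) / ((1 - r) ^ 2 + r * d a ^ 2) ∂m = ∫ s in Set.Ioi (0 : ℝ), G r s := by
    rintro r ⟨hr0, hr1⟩
    have hr : 0 < r := by linarith
    have hε : 0 < 1 - r := by linarith
    have h1 : ∀ a, (1 - r ^ 2) / ((1 - r) ^ 2 + r * d a ^ 2) =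
        (1 + r) / (1 - r) * (1 + r * (d a / (1 - r)) ^ 2)⁻¹ := by
      intro a
      have : 0 < (1 - r) ^ 2 + r * d a ^ 2 := by positivity
      field_simp
      ring
    simp_rw [h1]
    rw [integral_const_mul, integral_inv_one_add_mul_sq_eq m hd hd0 hr hε, ← integral_const_mul]
    refine setIntegral_congr_fun measurableSet_Ioi fun s (hs : 0 < s) => ?_
    have : 0 < 1 + r * s ^ 2 := by positivity
    simp only [G, F]
    field_simp
  refine ⟨∫ s in Set.Ioi (0 : ℝ), (1 + 1) * (2 * 1 * s ^ 2 / (1 + 1 * s ^ 2) ^ 2) * A, ?_⟩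
  refine Tendsto.congr' (hr_mem.mono fun r hr => (hEq r hr).symm) ?_
  refine tendsto_integral_filter_of_dominated_convergence
    (fun s => 16 * C * (1 + s ^ 2)⁻¹) ?_ ?_ ?_ ?_
  · refine Eventually.of_forall fun r => Measurable.aestronglyMeasurable ?_
    have := hFmono.measurable
    fun_prop
  · filter_upwards [hr_mem] with r ⟨hr0, hr1⟩
    filter_upwards [ae_restrict_mem measurableSet_Ioi] with s (hs : 0 < s)
    have hr : 0 < r := by linarith
    have hε : 0 < 1 - r := by linarith
    have hq0 : 0 ≤ F ((1 - r) * s) / ((1 - r) * s) := div_nonneg (hF0 _) (by positivity)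
    have hker : (1 + r) * (2 * r * s ^ 2 / (1 + r * s ^ 2) ^ 2) ≤ 16 * (1 + s ^ 2)⁻¹ := by
      have h1 : 2 * r * s ^ 2 / (1 + r * s ^ 2) ^ 2 ≤ 2 / (1 + r * s ^ 2) := by
        rw [div_le_div_iff₀ (by positivity) (by positivity)]
        nlinarith [show 0 ≤ r * s ^ 2 by positivity]
      have h2 : 2 / (1 + r * s ^ 2) ≤ 4 * (1 + s ^ 2)⁻¹ := by
        rw [← div_eq_mul_inv, div_le_div_iff₀ (by positivity) (by positivity)]
        nlinarith [sq_nonneg s]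
      have h3 : 0 ≤ 4 * (1 + s ^ 2)⁻¹ := by positivity
      nlinarith [h1.trans h2]
    rw [Real.norm_of_nonneg (mul_nonneg (by positivity) hq0)]
    calc _ ≤ 16 * (1 + s ^ 2)⁻¹ * C :=
          mul_le_mul hker (hC _ (by positivity)) hq0 (by positivity)
      _ = _ := by ring
  · exact (integrable_inv_one_add_sq.const_mul _).integrableOn
  · filter_upwards [ae_restrict_mem measurableSet_Ioi] with s (hs : 0 < s)
    have hlim : Tendsto (fun r : ℝ => (1 - r) * s) (𝓝[<] 1) (𝓝[>] 0) := by
      refine tendsto_nhdsWithin_iff.2 ⟨?_, ?_⟩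
      · have : Continuous fun r : ℝ => (1 - r) * s := by fun_prop
        simpa using (this.tendsto 1).mono_left nhdsWithin_le_nhds
      · filter_upwards [hr_mem] with r hr
        exact mul_pos (by linarith [hr.2]) hs
    refine Tendsto.mul ?_ (hA.comp hlim)
    have hc : ContinuousAt (fun r : ℝ => (1 + r) * (2 * r * s ^ 2 / (1 + r * s ^ 2) ^ 2)) 1 := by
      have : (1 + 1 * s ^ 2) ^ 2 ≠ 0 := by positivity
      fun_prop (disch := assumption)
    exact hc.tendsto.mono_left nhdsWithin_le_nhds

/-- With `d` standing for `|1 - w|` on the unit circle, this is `∫ log |1 - s w|`. -/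
noncomputable def radialLogPotential (m : Measure α) (d : α → ℝ) (s : ℝ) : ℝ :=
  ∫ a, Real.log ((1 - s) ^ 2 + s * d a ^ 2) / 2 ∂m

lemma hasDerivAt_radialLogPotential (m : Measure α) [IsProbabilityMeasure m] {d : α → ℝ}
    (hd : Measurable d) (hd0 : ∀ a, 0 ≤ d a) (hd2 : ∀ᵐ a ∂m, d a ≤ 2) {r : ℝ}
    (hr0 : 0 < r) (hr1 : r < 1) :
    HasDerivAt (radialLogPotential m d)
      ((1 - ∫ a, (1 - r ^ 2) / ((1 - r) ^ 2 + r * d a ^ 2) ∂m) / (2 * r)) r := by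
  have hpos : ∀ s ∈ Set.Ioo (0 : ℝ) 1, ∀ a, 0 < (1 - s) ^ 2 + s * d a ^ 2 := by
    rintro s ⟨hs0, hs1⟩ a
    have : 0 < 1 - s := by linarith
    positivity
  have hr : r ∈ Set.Ioo (0 : ℝ) 1 := ⟨hr0, hr1⟩
  let F' : ℝ → α → ℝ := fun s a =>
    (d a ^ 2 - 2 * (1 - s)) / ((1 - s) ^ 2 + s * d a ^ 2) / 2
  have hsub : Set.Ioo (0 : ℝ) ((1 + r) / 2) ⊆ Set.Ioo 0 1 :=
    Set.Ioo_subset_Ioo_right (by linarith)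
  have hlogint : Integrable (fun a => Real.log ((1 - r) ^ 2 + r * d a ^ 2) / 2) m := by
    refine Integrable.of_bound (C := (|Real.log ((1 - r) ^ 2)| + |Real.log 5|) / 2)
      (Measurable.aestronglyMeasurable (by fun_prop)) ?_
    filter_upwards [hd2] with a ha
    have hε : 0 < 1 - r := by linarith
    have h1 : Real.log ((1 - r) ^ 2) ≤ Real.log ((1 - r) ^ 2 + r * d a ^ 2) :=
      Real.log_le_log (by positivity) (le_add_of_nonneg_right (by positivity))
    have h2 : Real.log ((1 - r) ^ 2 + r * d a ^ 2) ≤ Real.log 5 :=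
      Real.log_le_log (hpos r hr a) (by nlinarith [hd0 a])
    rw [Real.norm_eq_abs, abs_div, abs_of_pos (two_pos : (0 : ℝ) < 2)]
    gcongr
    rw [abs_le]
    constructor
    · linarith [neg_abs_le (Real.log ((1 - r) ^ 2)), abs_nonneg (Real.log 5)]
    · linarith [le_abs_self (Real.log 5), abs_nonneg (Real.log ((1 - r) ^ 2))]
  have key := hasDerivAt_integral_of_dominated_loc_of_deriv_le (μ := m)
    (F := fun s a => Real.log ((1 - s) ^ 2 + s * d a ^ 2) / 2) (F' := F') (x₀ := r)
    (s := Set.Ioo (0 : ℝ) ((1 + r) / 2)) (bound := fun _ => 12 / (1 - r) ^ 2)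
    (Ioo_mem_nhds hr0 (by linarith))
    (Eventually.of_forall fun s => Measurable.aestronglyMeasurable (by fun_prop))
    hlogint (Measurable.aestronglyMeasurable (by fun_prop))
    (by
      filter_upwards [hd2] with a ha s hs
      have hQ := hpos s (hsub hs) a
      have hε : 0 < 1 - r := by linarith
      have hnum : |d a ^ 2 - 2 * (1 - s)| ≤ 6 := by
        rw [abs_le]
        constructor <;> nlinarith [hd0 a, hs.1, (hsub hs).2]
      have hQ' : (1 - r) ^ 2 / 4 ≤ (1 - s) ^ 2 + s * d a ^ 2 := by
        have : 0 ≤ s * d a ^ 2 := mul_nonneg hs.1.le (sq_nonneg _)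
        nlinarith [hs.2]
      rw [Real.norm_eq_abs, abs_div, abs_div, abs_of_pos hQ, abs_of_pos (two_pos : (0 : ℝ) < 2),
        div_div, div_le_div_iff₀ (by positivity) (by positivity)]
      calc _ ≤ 6 * (1 - r) ^ 2 := by gcongr
        _ ≤ _ := by linarith)
    (integrable_const _)
    (by
      refine Eventually.of_forall fun a s hs => ?_
      have hQ : HasDerivAt (fun s : ℝ => (1 - s) ^ 2 + s * d a ^ 2)
          (2 * (1 - s) * (-1) + 1 * d a ^ 2) s := by
        simpa using (((hasDerivAt_id s).const_sub 1).fun_pow 2).fun_add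
          ((hasDerivAt_id s).mul_const (d a ^ 2))
      refine ((hQ.log (hpos s (hsub hs) a).ne').div_const 2).congr_deriv ?_
      simp only [F']
      ring)
  have hker : ∀ a, (1 - r ^ 2) / ((1 - r) ^ 2 + r * d a ^ 2) = 1 - 2 * r * F' r a := by
    intro a
    have := (hpos r hr a).ne'
    simp only [F']
    field_simp
    ring
  simp_rw [hker]
  refine key.2.congr_deriv ?_
  rw [integral_sub (integrable_const _) (key.1.const_mul _), integral_const_mul]
  simp only [integral_const, probReal_univ, smul_eq_mul, mul_one, sub_sub_cancel]
  field_simp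

lemma tendsto_radialLogPotential (m : Measure α) [IsFiniteMeasure m] {d : α → ℝ}
    (hd : Measurable d) (hd0 : ∀ᵐ a ∂m, 0 < d a) (hd2 : ∀ᵐ a ∂m, d a ≤ 2)
    (hlog : Integrable (fun a => Real.log (d a)) m) :
    Tendsto (radialLogPotential m d) (𝓝[<] 1) (𝓝 (∫ a, Real.log (d a) ∂m)) := by
  refine tendsto_integral_filter_of_dominated_convergence
    (fun a => |Real.log (d a)| + (Real.log 4 + Real.log 5))
    (Eventually.of_forall fun s => Measurable.aestronglyMeasurable (by fun_prop)) ?_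
    (hlog.abs.add (integrable_const _)) ?_
  · filter_upwards [Ioo_mem_nhdsLT (show (1 / 4 : ℝ) < 1 by norm_num)] with r ⟨hr0, hr1⟩
    filter_upwards [hd0, hd2] with a ha0 ha2
    have h1 : Real.log (d a ^ 2 / 4) ≤ Real.log ((1 - r) ^ 2 + r * d a ^ 2) :=
      Real.log_le_log (by positivity) (by nlinarith [sq_nonneg (1 - r), sq_nonneg (d a)])
    have h2 : Real.log ((1 - r) ^ 2 + r * d a ^ 2) ≤ Real.log 5 :=
      Real.log_le_log (by nlinarith [sq_nonneg (1 - r), pow_pos ha0 2]) (by nlinarith)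
    rw [Real.log_div (by positivity) (by norm_num), Real.log_pow] at h1
    push_cast at h1
    have h4 : 0 ≤ Real.log 4 := Real.log_nonneg (by norm_num)
    have h5 : 0 ≤ Real.log 5 := Real.log_nonneg (by norm_num)
    have := neg_abs_le (Real.log (d a))
    have := abs_nonneg (Real.log (d a))
    rw [Real.norm_eq_abs, abs_le]
    constructor <;> linarith
  · filter_upwards [hd0] with a ha0
    have hc : ContinuousAt (fun r : ℝ => Real.log ((1 - r) ^ 2 + r * d a ^ 2) / 2) 1 := by
      have : (1 - 1) ^ 2 + 1 * d a ^ 2 ≠ 0 := by simp [ha0.ne']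
      fun_prop (disch := assumption)
    have h1 := hc.tendsto.mono_left (nhdsWithin_le_nhds (s := Set.Iio 1))
    simpa [Real.log_pow] using h1

/-- L'Hôpital at the boundary for the radial potential, where the derivative limit exists. -/
lemma exists_tendsto_deriv_radialLogPotential (m : Measure α) [IsProbabilityMeasure m]
    {d : α → ℝ} (hd : Measurable d) (hd0 : ∀ a, 0 ≤ d a) (hd2 : ∀ᵐ a ∂m, d a ≤ 2) {A : ℝ}
    (hA : Tendsto (fun t => m.real {a | d a ≤ t} / t) (𝓝[>] 0) (𝓝 A))
    (hlog : Integrable (fun a => Real.log (d a)) m) :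
    ∃ L : ℝ, Tendsto (deriv (radialLogPotential m d)) (𝓝[<] 1) (𝓝 L) ∧
      Tendsto (fun r => (radialLogPotential m d r - ∫ a, Real.log (d a) ∂m) / (1 - r))
        (𝓝[<] 1) (𝓝 (-L)) := by
  have hpos : ∀ᵐ a ∂m, 0 < d a := by
    have hF : Tendsto (fun t => m.real {a | d a ≤ t}) (𝓝[>] 0) (𝓝 0) := by
      have hid : Tendsto (fun t : ℝ => t) (𝓝[>] 0) (𝓝 0) := nhdsWithin_le_nhds
      have h := hA.mul hid
      rw [mul_zero] at h
      refine h.congr' ?_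
      filter_upwards [self_mem_nhdsWithin] with t (ht : 0 < t)
      field_simp
    have h0 : m.real {a | d a ≤ 0} ≤ 0 := by
      refine ge_of_tendsto hF ?_
      filter_upwards [self_mem_nhdsWithin] with t (ht : 0 < t)
      exact measureReal_mono fun a (ha : d a ≤ 0) => ha.trans ht.le
    have h1 : m {a | d a ≤ 0} = 0 :=
      (measureReal_eq_zero_iff).1 (le_antisymm h0 measureReal_nonneg)
    simpa [ae_iff] using h1
  obtain ⟨B, hB⟩ := exists_tendsto_poisson m hd hd0 hA
  let V' : ℝ → ℝ := fun r =>
    (1 - ∫ a, (1 - r ^ 2) / ((1 - r) ^ 2 + r * d a ^ 2) ∂m) / (2 * r)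
  have hV : ∀ r ∈ Set.Ioo (0 : ℝ) 1, HasDerivAt (radialLogPotential m d) (V' r) r :=
    fun r hr => hasDerivAt_radialLogPotential m hd hd0 hd2 hr.1 hr.2
  have hid : Tendsto (fun r : ℝ => r) (𝓝[<] 1) (𝓝 1) := nhdsWithin_le_nhds
  have hV' : Tendsto V' (𝓝[<] 1) (𝓝 ((1 - B) / (2 * 1))) :=
    (hB.const_sub 1).div (hid.const_mul 2) (by norm_num)
  refine ⟨_, hV'.congr' ?_, ?_⟩
  · filter_upwards [Ioo_mem_nhdsLT (zero_lt_one' ℝ)] with r hr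
    exact (hV r hr).deriv.symm
  · refine HasDerivAt.lhopital_zero_left_on_Ioo (a := 0) (f' := V') (g' := fun _ => -1)
      zero_lt_one (fun r hr => (hV r hr).sub_const _)
      (fun r _ => by simpa using (hasDerivAt_id r).const_sub 1) (by simp) ?_ ?_ ?_
    · simpa using (tendsto_radialLogPotential m hd hpos hd2 hlog).sub_const
        (∫ a, Real.log (d a) ∂m)
    · simpa using hid.const_sub 1
    · simpa only [div_neg, div_one] using hV'.neg

end RadialKernel

section CircleArc

lemma norm_exp_mul_I_sub_exp_mul_I (φ θ : ℝ) :
    ‖exp (φ * I) - exp (θ * I)‖ = 2 * |Real.sin ((φ - θ) / 2)| := by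
  have h : exp (φ * I) - exp (θ * I) = exp (θ * I) * (exp (I * (φ - θ : ℝ)) - 1) := by
    rw [mul_sub, ← Complex.exp_add, mul_one]
    congr 2
    push_cast
    ring
  rw [h, norm_mul, norm_exp_ofReal_mul_I, one_mul, norm_exp_I_mul_ofReal_sub_one, norm_mul]
  simp

/-- Arc length on the unit circle, as a measure on `ℂ`. -/
noncomputable def arcLength : Measure ℂ :=
  (volume.restrict (Set.Ioc 0 (0 + 2 * Real.pi))).map fun θ : ℝ => exp (θ * I)

lemma measurable_exp_ofReal_mul_I : Measurable fun θ : ℝ => exp (θ * I) := by fun_prop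

instance : IsFiniteMeasure arcLength := by
  unfold arcLength
  infer_instance

lemma arcLength_eq_map (a : ℝ) :
    arcLength = (volume.restrict (Set.Ioc a (a + 2 * Real.pi))).map
      fun θ : ℝ => exp (θ * I) := by
  have : Fact (0 < 2 * Real.pi) := ⟨Real.two_pi_pos⟩
  let f : AddCircle (2 * Real.pi) → ℂ := fun x => AddCircle.toCircle x
  have hf : Measurable f := by
    have : Continuous f := continuous_subtype_val.comp AddCircle.continuous_toCircle
    exact this.measurable
  have hcomp : (fun θ : ℝ => exp (θ * I)) =
      f ∘ (QuotientAddGroup.mk : ℝ → AddCircle (2 * Real.pi)) := by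
    funext θ
    have : (AddCircle.toCircle (θ : AddCircle (2 * Real.pi)) : ℂ) = exp (θ * I) := by
      rw [AddCircle.toCircle_apply_mk, Circle.coe_exp, div_self Real.two_pi_pos.ne', one_mul]
    exact this.symm
  have key : ∀ b : ℝ, (volume.restrict (Set.Ioc b (b + 2 * Real.pi))).map
      (fun θ : ℝ => exp (θ * I)) = (volume : Measure (AddCircle (2 * Real.pi))).map f := by
    intro b
    have hmk := AddCircle.measurePreserving_mk (2 * Real.pi) b
    rw [hcomp, ← Measure.map_map hf hmk.measurable, hmk.map_eq]
  rw [arcLength, key, key]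

lemma arcLength_closedBall (θ : ℝ) {t : ℝ} (ht0 : 0 < t) (ht2 : t < 2) :
    arcLength.real (Metric.closedBall (exp (θ * I)) t) = 4 * Real.arcsin (t / 2) := by
  have hpi := Real.pi_pos
  have harc_lt : Real.arcsin (t / 2) < Real.pi / 2 := by
    rw [Real.arcsin_lt_pi_div_two]; linarith
  have harc_pos : 0 < Real.arcsin (t / 2) := Real.arcsin_pos.2 (by linarith)
  have hset : (fun φ : ℝ => exp (φ * I)) ⁻¹' Metric.closedBall (exp (θ * I)) t ∩
        Set.Ioc (θ - Real.pi) (θ - Real.pi + 2 * Real.pi) =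
      Set.Icc (θ - 2 * Real.arcsin (t / 2)) (θ + 2 * Real.arcsin (t / 2)) := by
    ext φ
    simp only [Set.mem_inter_iff, Set.mem_preimage, mem_closedBall_iff_norm,
      norm_exp_mul_I_sub_exp_mul_I, Set.mem_Ioc, Set.mem_Icc]
    have hiff : ∀ x : ℝ, -(Real.pi / 2) ≤ x → x ≤ Real.pi / 2 →
        (2 * |Real.sin x| ≤ t ↔ -Real.arcsin (t / 2) ≤ x ∧ x ≤ Real.arcsin (t / 2)) := by
      intro x hx1 hx2
      rw [Real.le_arcsin_iff_sin_le ⟨hx1, hx2⟩ ⟨by linarith, by linarith⟩, ← Real.arcsin_neg,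
        Real.arcsin_le_iff_le_sin ⟨by linarith, by linarith⟩ ⟨hx1, hx2⟩, ← abs_le]
      constructor <;> intro h <;> linarith
    constructor
    · rintro ⟨h, h1, h2⟩
      have := (hiff ((φ - θ) / 2) (by linarith) (by linarith)).1 h
      constructor <;> linarith [this.1, this.2]
    · rintro ⟨h1, h2⟩
      exact ⟨(hiff ((φ - θ) / 2) (by linarith) (by linarith)).2
        ⟨by linarith, by linarith⟩, by linarith, by linarith⟩
  rw [arcLength_eq_map (θ - Real.pi), measureReal_def,
    Measure.map_apply measurable_exp_ofReal_mul_I Metric.isClosed_closedBall.measurableSet,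
    Measure.restrict_apply
      (measurable_exp_ofReal_mul_I Metric.isClosed_closedBall.measurableSet), hset,
    Real.volume_Icc, ENNReal.toReal_ofReal (by linarith)]
  ring

lemma tendsto_arcLength_closedBall_div (θ : ℝ) :
    Tendsto (fun t => arcLength.real (Metric.closedBall (exp (θ * I)) t) / t) (𝓝[>] 0) (𝓝 2) := by
  have h : HasDerivAt (fun t : ℝ => 4 * Real.arcsin (t / 2)) 2 0 := by
    have h1 : HasDerivAt Real.arcsin (1 / √(1 - (0 / 2 : ℝ) ^ 2)) (0 / 2 : ℝ) :=
      Real.hasDerivAt_arcsin (by norm_num) (by norm_num)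
    refine ((h1.comp (0 : ℝ) ((hasDerivAt_id (0 : ℝ)).div_const 2)).const_mul 4).congr_deriv ?_
    norm_num
  have h2 := h.tendsto_slope_zero_right
  refine h2.congr' ?_
  filter_upwards [Ioo_mem_nhdsGT (zero_lt_two' ℝ)] with t ht
  rw [arcLength_closedBall θ ht.1 ht.2]
  simp
  ring

/-- Lebesgue differentiation on the circle, with chordal balls. -/
lemma ae_exists_tendsto_measureReal_closedBall_div (k : Measure ℂ) [IsFiniteMeasure k] :
    ∀ᵐ θ : ℝ ∂(volume.restrict (Set.Ico (0 : ℝ) (2 * Real.pi))),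
      ∃ A : ℝ, Tendsto (fun t => k.real (Metric.closedBall (exp (θ * I)) t) / t)
        (𝓝[>] 0) (𝓝 A) := by
  have h := (Besicovitch.ae_tendsto_rnDeriv k arcLength).and (k.rnDeriv_lt_top arcLength)
  have h' := ae_of_ae_map measurable_exp_ofReal_mul_I.aemeasurable h
  rw [zero_add, ← restrict_Ico_eq_restrict_Ioc] at h'
  filter_upwards [h'] with θ ⟨hlim, hfin⟩
  refine ⟨_, Tendsto.congr' ?_ (((ENNReal.tendsto_toReal hfin.ne).comp hlim).mul
    (tendsto_arcLength_closedBall_div θ))⟩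
  filter_upwards [Ioo_mem_nhdsGT (zero_lt_two' ℝ)] with t ht
  have hpos : 0 < arcLength.real (Metric.closedBall (exp (θ * I)) t) := by
    rw [arcLength_closedBall θ ht.1 ht.2]
    have := Real.arcsin_pos.2 (show 0 < t / 2 by linarith [ht.1])
    linarith
  simp only [Function.comp_apply, ENNReal.toReal_div, ← measureReal_def]
  field_simp

end CircleArc

lemma norm_one_sub_real_mul_sq {w : ℂ} (hw : ‖w‖ = 1) (s : ℝ) :
    ‖1 - s * w‖ ^ 2 = (1 - s) ^ 2 + s * ‖1 - w‖ ^ 2 := by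
  have h : w.re * w.re + w.im * w.im = 1 := by
    rw [← normSq_apply, normSq_eq_norm_sq, hw, one_pow]
  simp only [← normSq_eq_norm_sq, normSq_apply, sub_re, sub_im, mul_re, mul_im, ofReal_re,
    ofReal_im, one_re, one_im]
  linear_combination (s ^ 2 - s) * h

lemma norm_one_sub_mul_conj {z τ : ℂ} (hτ : ‖τ‖ = 1) :
    ‖1 - z * (starRingEnd ℂ) τ‖ = ‖τ - z‖ := by
  have h : (starRingEnd ℂ) τ * τ = 1 := by
    rw [mul_comm, mul_conj, normSq_eq_norm_sq, hτ]
    norm_num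
  have : (1 - z * (starRingEnd ℂ) τ) * τ = τ - z := by
    linear_combination (-z) * h
  rw [← this, norm_mul, hτ, mul_one]

/-- With `u(z) = ∫ log|1 - z·conj τ| dk(τ) - log ρ` for a probability measure
`k` on the unit circle and `ρ > 0`, for Lebesgue-a.e. `θ ∈ [0,2π)` at which
`u(e^{iθ})` is (well defined, i.e. the integrand is integrable, and) equal to
`0`, both radial limits `lim_{r↑1} (∂u/∂r)(re^{iθ})` and
`lim_{r↑1} u(re^{iθ})/(1-r)` exist and
`lim_{r↑1} (∂u/∂r)(re^{iθ}) = -lim_{r↑1} u(re^{iθ})/(1-r)`. -/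
theorem radial_deriv_limit_eq_neg_quotient_limit
    (k : Measure ℂ) [IsProbabilityMeasure k] (hk : ∀ᵐ τ ∂k, ‖τ‖ = 1)
    (ρ : ℝ) (hρ : 0 < ρ)
    (u : ℂ → ℝ)
    (hu : ∀ z : ℂ,
      u z = (∫ τ, Real.log ‖1 - z * (starRingEnd ℂ) τ‖ ∂k) - Real.log ρ) :
    ∀ᵐ (θ : ℝ) ∂(volume.restrict (Set.Ico (0 : ℝ) (2 * Real.pi))),
      (Integrable
          (fun τ => Real.log ‖1 - Complex.exp (θ * Complex.I) * (starRingEnd ℂ) τ‖) k ∧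
        u (Complex.exp (θ * Complex.I)) = 0) →
      ∃ L : ℝ,
        Tendsto (fun r : ℝ =>
            deriv (fun s : ℝ => u ((s : ℂ) * Complex.exp (θ * Complex.I))) r)
          (𝓝[<] (1 : ℝ)) (𝓝 L) ∧
        Tendsto (fun r : ℝ => u ((r : ℂ) * Complex.exp (θ * Complex.I)) / (1 - r))
          (𝓝[<] (1 : ℝ)) (𝓝 (-L)) := by
  filter_upwards [ae_exists_tendsto_measureReal_closedBall_div k] with θ ⟨A, hA⟩ ⟨hint, hzero⟩
  set e : ℂ := Complex.exp (θ * Complex.I) with he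
  have he1 : ‖e‖ = 1 := norm_exp_ofReal_mul_I θ
  let d : ℂ → ℝ := fun τ => ‖τ - e‖
  have hd : Measurable d := by fun_prop
  have hd2 : ∀ᵐ τ ∂k, d τ ≤ 2 := by
    filter_upwards [hk] with τ hτ
    exact (norm_sub_le τ e).trans (by rw [hτ, he1]; norm_num)
  have hlog_eq : (fun τ => Real.log ‖1 - e * (starRingEnd ℂ) τ‖) =ᵐ[k]
      fun τ => Real.log (d τ) := by
    filter_upwards [hk] with τ hτ
    rw [norm_one_sub_mul_conj hτ]
  have hball : ∀ t, {τ | d τ ≤ t} = Metric.closedBall e t := fun t => by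
    ext τ
    simp [d, dist_eq_norm]
  simp_rw [← hball] at hA
  have hc : ∫ τ, Real.log (d τ) ∂k = Real.log ρ := by
    rw [hu, integral_congr_ae hlog_eq] at hzero
    linarith
  have hus : ∀ s : ℝ, u (s * e) = radialLogPotential k d s - Real.log ρ := by
    intro s
    rw [hu, radialLogPotential]
    congr 1
    refine integral_congr_ae ?_
    filter_upwards [hk] with τ hτ
    have hw : ‖e * (starRingEnd ℂ) τ‖ = 1 := by rw [norm_mul, he1, RCLike.norm_conj, hτ, one_mul]
    have hsq := norm_one_sub_real_mul_sq hw s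
    rw [norm_one_sub_mul_conj hτ, ← mul_assoc] at hsq
    rw [← hsq, Real.log_pow]
    push_cast
    ring
  obtain ⟨L, hL1, hL2⟩ := exists_tendsto_deriv_radialLogPotential k hd
    (fun τ => norm_nonneg _) hd2 hA (hint.congr hlog_eq)
  rw [hc] at hL2
  refine ⟨L, ?_, ?_⟩
  · simpa only [hus, deriv_sub_const] using hL1
  · simpa only [hus] using hL2
end
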